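/- Let K be a field and X, Y, Z nonzero finite-dimensional vector spaces over K. Put U = Hom_K(X,Y), V = Hom_K(Y,Z), W = Hom_K(X,Z), and let A, B, C be linear automorphisms of U, V, W respectively, such that (B v) ∘ (A u) = C(v ∘ u) for all u ∈ U and v ∈ V. Then there exist linear automorphisms p of X, q of Y, and r of Z such that A u = q ∘ u ∘ p⁻¹ for all u ∈ U, B v = r ∘ v ∘ q⁻¹ for all v ∈ V, and C w = r ∘ w ∘ p⁻¹ for all w ∈ W. -/

import Mathlib

open LinearMap

open Module in
/-- Linear maps into a nontrivial space separate points. -/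
lemma eq_of_forall_linearMap_apply_eq {K V W : Type*} [Field K]
    [AddCommGroup V] [Module K V] [AddCommGroup W] [Module K W] [Nontrivial W]
    {x y : V} (h : ∀ f : V →ₗ[K] W, f x = f y) : x = y := by
  obtain ⟨w, hw⟩ := exists_ne (0 : W)
  rw [← sub_eq_zero, ← forall_dual_apply_eq_zero_iff K]
  intro f
  have hf := h (f.smulRight w)
  simp only [smulRight_apply] at hf
  rw [map_sub, sub_eq_zero]
  exact smul_left_injective K hw hf

/-- There are a vector and a linear functional on a nontrivial space with pairing `1`. -/
lemma exists_dual_apply_eq_one (K V : Type*) [Field K]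
    [AddCommGroup V] [Module K V] [Nontrivial V] :
    ∃ (x : V) (f : V →ₗ[K] K), f x = 1 := by
  obtain ⟨x, hx⟩ := exists_ne (0 : V)
  exact ⟨x, Module.Projective.exists_dual_eq_one K hx⟩

/-- Linear maps out of a nontrivial space are determined by their compositions with
all linear maps into their domain. -/
lemma eq_of_forall_comp_eq {K X Y Z : Type*} [Field K]
    [AddCommGroup X] [Module K X] [AddCommGroup Y] [Module K Y]
    [AddCommGroup Z] [Module K Z] [Nontrivial X] {S T : Y →ₗ[K] Z}
    (h : ∀ u : X →ₗ[K] Y, S ∘ₗ u = T ∘ₗ u) : S = T := by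
  obtain ⟨x, f, hf⟩ := exists_dual_apply_eq_one K X
  ext y
  simpa [hf] using congr($(h (f.smulRight y)) x)

/-- A linear map between `Hom` spaces commuting with precomposition is a postcomposition. -/
lemma exists_eq_comp_of_map_comp {K X Y Z : Type*} [Field K]
    [AddCommGroup X] [Module K X] [AddCommGroup Y] [Module K Y]
    [AddCommGroup Z] [Module K Z] [Nontrivial X]
    (F : (X →ₗ[K] Y) →ₗ[K] (X →ₗ[K] Z))
    (hF : ∀ (u : X →ₗ[K] Y) (S : X →ₗ[K] X), F (u ∘ₗ S) = F u ∘ₗ S) :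
    ∃ T : Y →ₗ[K] Z, ∀ u, F u = T ∘ₗ u := by
  obtain ⟨x₀, f, hf⟩ := exists_dual_apply_eq_one K X
  refine ⟨applyₗ x₀ ∘ₗ F ∘ₗ smulRightₗ f, fun u ↦ ?_⟩
  ext x
  have hu : u ∘ₗ f.smulRight x = f.smulRight (u x) := by ext; simp
  have := congr($(hF u (f.smulRight x)) x₀)
  rw [hu] at this
  simpa [hf, smulRightₗ] using this.symm

/-- A linear map between `Hom` spaces commuting with postcomposition is a precomposition. -/
lemma exists_eq_comp_of_map_comp_left {K X X' Y : Type*} [Field K]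
    [AddCommGroup X] [Module K X] [AddCommGroup X'] [Module K X']
    [AddCommGroup Y] [Module K Y] [FiniteDimensional K X] [Nontrivial Y]
    (F : (X →ₗ[K] Y) →ₗ[K] (X' →ₗ[K] Y))
    (hF : ∀ (T : Y →ₗ[K] Y) (u : X →ₗ[K] Y), F (T ∘ₗ u) = T ∘ₗ F u) :
    ∃ S : X' →ₗ[K] X, ∀ u, F u = u ∘ₗ S := by
  obtain ⟨y₀, g, hg⟩ := exists_dual_apply_eq_one K Y
  let D : Module.Dual K X →ₗ[K] X' →ₗ[K] K :=
    { toFun := fun f ↦ g ∘ₗ F (f.smulRight y₀)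
      map_add' := fun f f' ↦ by
        rw [← comp_add, ← map_add]; congr 2; ext; simp [add_smul]
      map_smul' := fun c f ↦ by
        rw [RingHom.id_apply, ← comp_smul, ← map_smul]; congr 2; ext; simp [mul_smul] }
  refine ⟨(Module.evalEquiv K X).symm.toLinearMap ∘ₗ D.flip, fun u ↦ ?_⟩
  ext x
  refine eq_of_forall_linearMap_apply_eq (K := K) (W := K) fun f ↦ ?_
  have hu : (f ∘ₗ u).smulRight y₀ = f.smulRight y₀ ∘ₗ u := by ext; simp
  have key : (f ∘ₗ u) ((Module.evalEquiv K X).symm (D.flip x)) = f (F u x) := by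
    rw [Module.apply_evalEquiv_symm_apply]
    simp [D, hu, hF, hg]
  exact key.symm

open Module in
/-- The endomorphism algebra automorphism of the middle space induced by an isotropy of the
composition map is inner. -/
lemma exists_conj_of_comp_eq {K X Y Z : Type*} [Field K]
    [AddCommGroup X] [Module K X] [AddCommGroup Y] [Module K Y]
    [AddCommGroup Z] [Module K Z] [FiniteDimensional K Y]
    [Nontrivial X] [Nontrivial Z]
    (A : (X →ₗ[K] Y) ≃ₗ[K] (X →ₗ[K] Y))
    (B : (Y →ₗ[K] Z) ≃ₗ[K] (Y →ₗ[K] Z))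
    (C : (X →ₗ[K] Z) ≃ₗ[K] (X →ₗ[K] Z))
    (h : ∀ (u : X →ₗ[K] Y) (v : Y →ₗ[K] Z), (B v) ∘ₗ (A u) = C (v ∘ₗ u)) :
    ∃ q : Y ≃ₗ[K] Y, ∀ (T : Y →ₗ[K] Y) (u : X →ₗ[K] Y),
      A (T ∘ₗ u) = q.toLinearMap ∘ₗ T ∘ₗ q.symm.toLinearMap ∘ₗ A u := by
  have hmid (T : Y →ₗ[K] Y) (u : X →ₗ[K] Y) (v : Y →ₗ[K] Z) :
      B v ∘ₗ A (T ∘ₗ A.symm u) = B (v ∘ₗ T) ∘ₗ u := by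
    rw [h, ← comp_assoc, ← h, A.apply_symm_apply]
  have hex (T : Y →ₗ[K] Y) : ∃ T' : Y →ₗ[K] Y, ∀ u, A (T ∘ₗ A.symm u) = T' ∘ₗ u := by
    refine exists_eq_comp_of_map_comp
      (A.toLinearMap ∘ₗ T.compRight K ∘ₗ A.symm.toLinearMap) fun u S ↦ ?_
    ext x
    refine eq_of_forall_linearMap_apply_eq (K := K) (W := Z) fun v ↦ ?_
    obtain ⟨v, rfl⟩ := B.surjective v
    have h₁ := congr($(hmid T (u ∘ₗ S) v) x)
    have h₂ := congr($(hmid T u v) (S x))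
    exact h₁.trans h₂.symm
  choose ψ hψ using hex
  have hψA (T : Y →ₗ[K] Y) (u : X →ₗ[K] Y) : A (T ∘ₗ u) = ψ T ∘ₗ A u := by
    rw [← hψ, A.symm_apply_apply]
  have huniq {T T' : Y →ₗ[K] Y} (hT : ∀ u, A (T ∘ₗ A.symm u) = T' ∘ₗ u) : ψ T = T' :=
    eq_of_forall_comp_eq (X := X) fun u ↦ by rw [← hψ, hT]
  let Ψ : End K Y →ₗ[K] End K Y :=
    { toFun := ψ
      map_add' := fun S T ↦ huniq fun u ↦ by
        rw [add_comp, add_comp, map_add, hψ, hψ]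
      map_smul' := fun c T ↦ huniq fun u ↦ by
        rw [RingHom.id_apply, smul_comp, smul_comp, map_smul, hψ] }
  let Φ : End K Y →ₐ[K] End K Y := AlgHom.ofLinearMap Ψ
    (huniq fun u ↦ by simp [End.one_eq_id])
    fun S T ↦ huniq fun u ↦ by
      rw [End.mul_eq_comp, End.mul_eq_comp, comp_assoc, hψA, hψ, comp_assoc]; rfl
  have hinj : Function.Injective Φ := fun S T hST ↦ by
    refine eq_of_forall_comp_eq (X := X) fun u ↦ A.injective ?_
    rw [hψA, hψA]
    exact congr($hST ∘ₗ A u)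
  have hbij : Function.Bijective Φ :=
    ⟨hinj, (LinearMap.injective_iff_surjective (f := Φ.toLinearMap)).mp hinj⟩
  obtain ⟨q, hq⟩ := (AlgEquiv.ofBijective Φ hbij).eq_linearEquivConjAlgEquiv
  refine ⟨q, fun T u ↦ ?_⟩
  have hT : ψ T = q.toLinearMap ∘ₗ T ∘ₗ q.symm.toLinearMap := congr($hq T)
  rw [hψA, hT, comp_assoc, comp_assoc]

/-- The isotropy group of the composition map: if `(B v) ∘ (A u) = C (v ∘ u)` for all
`u ∈ Hom(X,Y)`, `v ∈ Hom(Y,Z)`, then `A`, `B`, `C` are simultaneous sandwich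
transformations by automorphisms `p`, `q`, `r` of `X`, `Y`, `Z`. -/
theorem composition_isotropy (K X Y Z : Type*) [Field K]
    [AddCommGroup X] [Module K X] [AddCommGroup Y] [Module K Y]
    [AddCommGroup Z] [Module K Z]
    [FiniteDimensional K X] [FiniteDimensional K Y] [FiniteDimensional K Z]
    [Nontrivial X] [Nontrivial Y] [Nontrivial Z]
    (A : (X →ₗ[K] Y) ≃ₗ[K] (X →ₗ[K] Y))
    (B : (Y →ₗ[K] Z) ≃ₗ[K] (Y →ₗ[K] Z))
    (C : (X →ₗ[K] Z) ≃ₗ[K] (X →ₗ[K] Z))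
    (h : ∀ (u : X →ₗ[K] Y) (v : Y →ₗ[K] Z), (B v) ∘ₗ (A u) = C (v ∘ₗ u)) :
    ∃ (p : X ≃ₗ[K] X) (q : Y ≃ₗ[K] Y) (r : Z ≃ₗ[K] Z),
      (∀ u : X →ₗ[K] Y, A u = q.toLinearMap ∘ₗ u ∘ₗ p.symm.toLinearMap) ∧
      (∀ v : Y →ₗ[K] Z, B v = r.toLinearMap ∘ₗ v ∘ₗ q.symm.toLinearMap) ∧
      (∀ w : X →ₗ[K] Z, C w = r.toLinearMap ∘ₗ w ∘ₗ p.symm.toLinearMap) := by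
  obtain ⟨q, hq⟩ := exists_conj_of_comp_eq A B C h
  obtain ⟨s, hs⟩ := exists_eq_comp_of_map_comp_left
    (q.symm.toLinearMap.compRight K ∘ₗ A.toLinearMap) fun T u ↦ by
      ext x
      simp [hq]
  have hA (u : X →ₗ[K] Y) : A u = q.toLinearMap ∘ₗ u ∘ₗ s := by
    rw [← hs]
    ext x
    simp
  have hs_inj : Function.Injective s := fun x y hxy ↦ by
    refine eq_of_forall_linearMap_apply_eq (K := K) (W := Y) fun f ↦ ?_
    obtain ⟨u, rfl⟩ := A.surjective f
    simp [hA, hxy]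
  let p : X ≃ₗ[K] X := (LinearEquiv.ofInjectiveEndo s hs_inj).symm
  have hp : p.symm.toLinearMap = s := rfl
  have hC (u : X →ₗ[K] Y) (v : Y →ₗ[K] Z) :
      C (v ∘ₗ u) = B v ∘ₗ q.toLinearMap ∘ₗ u ∘ₗ s := by
    rw [← h, hA]
  have hC' (u : X →ₗ[K] Y) (v : Y →ₗ[K] Z) :
      C (v ∘ₗ u) ∘ₗ p.toLinearMap = B v ∘ₗ q.toLinearMap ∘ₗ u := by
    rw [hC, ← hp]
    ext x
    simp
  obtain ⟨r, hr⟩ := exists_eq_comp_of_map_comp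
    (lcomp K Z q.toLinearMap ∘ₗ B.toLinearMap) fun v T ↦ by
      refine eq_of_forall_comp_eq (X := X) fun u ↦ ?_
      have h₁ := hC' u (v ∘ₗ T)
      have h₂ := hC' (T ∘ₗ u) v
      exact h₁.symm.trans h₂
  have hB (v : Y →ₗ[K] Z) : B v = r ∘ₗ v ∘ₗ q.symm.toLinearMap := by
    rw [← comp_assoc, ← hr]
    ext y
    simp
  obtain ⟨y₀, g, hg⟩ := exists_dual_apply_eq_one K Y
  have hr_surj : Function.Surjective r := fun z ↦ by
    obtain ⟨v, hv⟩ := B.surjective (g.smulRight z)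
    refine ⟨v (q.symm y₀), ?_⟩
    have := congr($hv y₀)
    simpa [hB, hg] using this
  let r' : Z ≃ₗ[K] Z := LinearEquiv.ofBijective r
    ⟨LinearMap.injective_iff_surjective.mpr hr_surj, hr_surj⟩
  have hr' (z : Z) : r' z = r z := rfl
  refine ⟨p, q, r', hA, hB, fun w ↦ ?_⟩
  let b := Module.finBasis K X
  have hw : w = ∑ i, g.smulRight (w (b i)) ∘ₗ (b.coord i).smulRight y₀ := by
    refine b.ext fun j ↦ ?_
    simp [hg, Finsupp.single_apply, ite_smul, apply_ite]
  rw [hw, map_sum]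
  ext x
  simp [hC, hB, hp, hr']
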